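/- arXiv:1204.0432 — 2 statements merged into one kernel-verified Lean document; each statement's English description precedes it below -/
import Mathlib

section
/- For a real Banach space V the following conditions are equivalent: (i) V is reflexive, i.e. the canonical embedding of V into its double dual V** is surjective; (ii) E(V) = {T*|_{B*} : T ∈ Θ(V)}, i.e. the set of restrictions to B* of adjoints of contractions is already closed in (B*)^{B*}; (iii) for every p ∈ E(V) the left translation λ_p : E(V) → E(V), q ↦ p ∘ q, is continuous (E(V) is a semitopological semigroup). -/
open scoped Topology

/-- The closed unit ball of the dual of `V`, with the weak* topology. -/
abbrev DualBall (V : Type*) [NormedAddCommGroup V] [NormedSpace ℝ V] :=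
  {ψ : WeakDual ℝ V // ∀ v : V, |ψ v| ≤ ‖v‖}

/-- The maps `B* → B*` induced by adjoints of contraction operators `T ∈ Θ(V)`. -/
def adjMaps (V : Type*) [NormedAddCommGroup V] [NormedSpace ℝ V] :
    Set (DualBall V → DualBall V) :=
  {p | ∃ T : V →L[ℝ] V, ‖T‖ ≤ 1 ∧ ∀ (ψ : DualBall V) (v : V), (p ψ).1 v = ψ.1 (T v)}

/-- The enveloping semigroup `E(V)` of a Banach space `V`: the pointwise closure of the
adjoint maps of contractions in the product space `(B*)^(B*)`. -/
def EnvSemigroup (V : Type*) [NormedAddCommGroup V] [NormedSpace ℝ V] :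
    Set (DualBall V → DualBall V) :=
  closure (adjMaps V)


open Set

section BidualApproximation

set_option maxSynthPendingDepth 3

variable {V : Type*} [NormedAddCommGroup V] [NormedSpace ℝ V]

/-- **Goldstine's theorem**: the unit ball of `V` is weak* dense in the unit ball of the bidual. -/
theorem mem_closure_inclusionInDoubleDual_closedBall (F : StrongDual ℝ (StrongDual ℝ V))
    (hF : ‖F‖ ≤ 1) :
    StrongDual.toWeakDual F ∈ closure
      ((fun v : V => StrongDual.toWeakDual (NormedSpace.inclusionInDoubleDual ℝ V v)) ''
        Metric.closedBall 0 1) := by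
  by_contra hmem
  have hconv : Convex ℝ
      ((fun v : V => StrongDual.toWeakDual (NormedSpace.inclusionInDoubleDual ℝ V v)) ''
        Metric.closedBall 0 1) :=
    (convex_closedBall (0 : V) 1).linear_image
      (StrongDual.toWeakDual.toLinearMap ∘ₗ (NormedSpace.inclusionInDoubleDual ℝ V).toLinearMap)
  have : LocallyConvexSpace ℝ (WeakDual ℝ (StrongDual ℝ V)) :=
    inferInstanceAs (LocallyConvexSpace ℝ (WeakBilin (topDualPairing ℝ (StrongDual ℝ V))))
  obtain ⟨f, u, hlt, hu⟩ := geometric_hahn_banach_closed_point hconv.closure isClosed_closure hmem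
  obtain ⟨φ, rfl⟩ := LinearMap.dualEmbedding_surjective _ f
  have hball : ∀ v : V, ‖v‖ ≤ 1 → φ v < u := fun v hv =>
    hlt _ (subset_closure ⟨v, by simpa using hv, rfl⟩)
  have hFu : u < F φ := hu
  have hu0 : 0 ≤ u := by simpa using (hball 0 (by simp)).le
  have hφ : ‖φ‖ ≤ u := by
    refine φ.opNorm_le_of_unit_norm hu0 fun v hv => ?_
    rw [Real.norm_eq_abs, abs_le]
    have h1 := hball v hv.le
    have h2 := hball (-v) (by simp [hv])
    rw [map_neg] at h2
    constructor <;> linarith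
  have h3 : F φ ≤ 1 * ‖φ‖ := (le_abs_self _).trans (F.le_of_opNorm_le hF φ)
  linarith

/-- A functional on the dual that is weak* continuous at `0` on the dual ball is approximated in
norm by evaluations. -/
theorem exists_norm_sub_inclusionInDoubleDual_le (F : StrongDual ℝ (StrongDual ℝ V))
    (hF : Continuous fun φ : DualBall V => F (WeakDual.toStrongDual φ.1)) {ε : ℝ} (hε : 0 < ε) :
    ∃ v : V, ‖F - NormedSpace.inclusionInDoubleDual ℝ V v‖ ≤ ε := by
  let z : DualBall V := ⟨0, fun v => by
    change |(0 : ℝ)| ≤ ‖v‖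
    simp⟩
  have hz : Filter.Tendsto (fun φ : DualBall V => F (WeakDual.toStrongDual φ.1)) (𝓝 z) (𝓝 0) := by
    have h := hF.tendsto z
    simpa [z] using h
  have hind : Topology.IsInducing fun (φ : DualBall V) (v : V) => φ.1 v :=
    (Topology.IsInducing.mk rfl :
      Topology.IsInducing fun (φ : WeakDual ℝ V) (v : V) => φ v).comp .subtypeVal
  have hsmall := hz (Metric.ball_mem_nhds 0 hε)
  rw [Filter.mem_map, hind.nhds_eq_comap, Filter.mem_comap] at hsmall
  obtain ⟨t, ht, hts⟩ := hsmall
  rw [nhds_pi, Filter.mem_pi] at ht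
  obtain ⟨I, hI, s, hs, hst⟩ := ht
  have key : ∀ φ : StrongDual ℝ V, ‖φ‖ ≤ 1 → (∀ v ∈ I, φ v = 0) → |F φ| < ε := by
    intro φ hφ h0
    let ψ : DualBall V := ⟨StrongDual.toWeakDual φ, fun v => by
      simpa using φ.le_of_opNorm_le hφ v⟩
    have hψ : ψ ∈ (fun φ : DualBall V => F (WeakDual.toStrongDual φ.1)) ⁻¹' Metric.ball 0 ε := by
      refine hts (hst fun v hv => ?_)
      have : (0 : ℝ) ∈ s v := mem_of_mem_nhds (hs v)
      simpa [ψ, h0 v hv] using this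
    simpa [ψ] using hψ
  let N : Submodule ℝ (StrongDual ℝ V) :=
    ⨅ v : I, LinearMap.ker (NormedSpace.inclusionInDoubleDual ℝ V v).toLinearMap
  have hN : ∀ φ ∈ N, ∀ v ∈ I, φ v = 0 := fun φ hφ v hv => by
    simpa using (Submodule.mem_iInf _).1 hφ ⟨v, hv⟩
  have hbound : ‖F.comp N.subtypeL‖ ≤ ε := by
    refine ContinuousLinearMap.opNorm_le_of_unit_norm hε.le fun φ hφ => ?_
    exact (key φ.1 (by simpa using hφ.le) (hN φ.1 φ.2)).le
  obtain ⟨G, hG, hGn⟩ := exists_extension_norm_eq N (F.comp N.subtypeL)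
  have hspan : (F - G).toLinearMap ∈ Submodule.span ℝ (range fun v : I =>
      (NormedSpace.inclusionInDoubleDual ℝ V v).toLinearMap) := by
    have := hI.to_subtype
    refine mem_span_of_iInf_ker_le_ker fun φ hφ => ?_
    have := hG ⟨φ, hφ⟩
    simp at this
    simp [this]
  have hrange : (F - G).toLinearMap ∈ LinearMap.range
      (ContinuousLinearMap.coeLM ℝ ∘ₗ (NormedSpace.inclusionInDoubleDual ℝ V).toLinearMap) := by
    refine Submodule.span_le.2 ?_ hspan
    rintro _ ⟨v, rfl⟩
    exact ⟨v, rfl⟩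
  obtain ⟨v, hv⟩ := hrange
  refine ⟨v, ?_⟩
  have hv' : NormedSpace.inclusionInDoubleDual ℝ V v = F - G := ContinuousLinearMap.coe_injective hv
  rw [hv', sub_sub_cancel, hGn]
  exact hbound

/-- In a Banach space, a bidual functional that is weak* continuous on the dual ball is an
evaluation. -/
theorem mem_range_inclusionInDoubleDual_of_continuous [CompleteSpace V]
    (F : StrongDual ℝ (StrongDual ℝ V))
    (hF : Continuous fun φ : DualBall V => F (WeakDual.toStrongDual φ.1)) :
    F ∈ range (NormedSpace.inclusionInDoubleDual ℝ V) := by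
  have hclosed : IsClosed (range (NormedSpace.inclusionInDoubleDual ℝ V)) :=
    (NormedSpace.inclusionInDoubleDualLi (E := V) ℝ).isometry.isClosedEmbedding.isClosed_range
  rw [← hclosed.closure_eq, Metric.mem_closure_iff]
  intro ε hε
  obtain ⟨v, hv⟩ := exists_norm_sub_inclusionInDoubleDual_le F hF (half_pos hε)
  exact ⟨_, ⟨v, rfl⟩, by rw [dist_eq_norm]; linarith⟩

end BidualApproximation

namespace DualBall

variable {V : Type*} [NormedAddCommGroup V] [NormedSpace ℝ V]

theorem continuous_eval (v : V) : Continuous fun φ : DualBall V => φ.1 v :=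
  (WeakDual.eval_continuous v).comp continuous_subtype_val

theorem continuous_of_eval {X : Type*} [TopologicalSpace X] {g : X → DualBall V}
    (h : ∀ v, Continuous fun x => (g x).1 v) : Continuous g :=
  Continuous.subtype_mk (WeakDual.continuous_of_continuous_eval h) fun x => (g x).2

theorem ext_eval {φ ψ : DualBall V} (h : ∀ v, φ.1 v = ψ.1 v) : φ = ψ :=
  Subtype.ext (DFunLike.ext _ _ h)

/-- The element of the dual ball determined by a functional of norm at most `1`. -/
noncomputable def ofNormLE (φ : StrongDual ℝ V) (hφ : ‖φ‖ ≤ 1) : DualBall V :=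
  ⟨StrongDual.toWeakDual φ, fun v => by simpa using φ.le_of_opNorm_le hφ v⟩

/-- Multiplication of an element of the dual ball by a scalar truncated to `[-1, 1]`. -/
noncomputable def truncSMul (c : ℝ) (φ : DualBall V) : DualBall V :=
  ⟨(projIcc (-1 : ℝ) 1 (by norm_num) c : ℝ) • φ.1, fun v => by
    have h := abs_le.2 (projIcc (-1 : ℝ) 1 (by norm_num) c).2
    calc |(projIcc (-1 : ℝ) 1 (by norm_num) c : ℝ) * φ.1 v|
        = |(projIcc (-1 : ℝ) 1 (by norm_num) c : ℝ)| * |φ.1 v| := abs_mul _ _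
      _ ≤ 1 * ‖v‖ := mul_le_mul h (φ.2 v) (abs_nonneg _) zero_le_one
      _ = ‖v‖ := one_mul _⟩

theorem truncSMul_apply {c : ℝ} (hc : |c| ≤ 1) (φ : DualBall V) (v : V) :
    (truncSMul c φ).1 v = c * φ.1 v := by
  change (projIcc (-1 : ℝ) 1 (by norm_num) c : ℝ) * φ.1 v = _
  rw [projIcc_of_mem _ (abs_le.1 hc)]

theorem continuous_truncSMul :
    Continuous fun x : ℝ × DualBall V => truncSMul x.1 x.2 :=
  continuous_of_eval fun v => Continuous.mul
    (continuous_subtype_val.comp (continuous_projIcc.comp continuous_fst))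
    ((continuous_eval v).comp continuous_snd)

/-- The positive multiple of norm at most `1` of a functional obtained by dividing by its norm. -/
noncomputable def normalize (φ : StrongDual ℝ V) : DualBall V :=
  ofNormLE (‖φ‖⁻¹ • φ) <| by
    rw [norm_smul, norm_inv, norm_norm]
    exact inv_mul_le_one

end DualBall

section EnvSemigroup

set_option maxSynthPendingDepth 3

open DualBall

variable {V : Type*} [NormedAddCommGroup V] [NormedSpace ℝ V]

/-- The positively homogeneous extension of `p : B* → B*` to the dual space. -/
noncomputable def homExtend (p : DualBall V → DualBall V) (φ : StrongDual ℝ V) : StrongDual ℝ V :=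
  ‖φ‖ • WeakDual.toStrongDual (p (normalize φ)).1

theorem continuous_homExtend_apply (φ : StrongDual ℝ V) (v : V) :
    Continuous fun p : DualBall V → DualBall V => homExtend p φ v :=
  continuous_const.mul ((continuous_eval v).comp (continuous_apply (normalize φ)))

theorem norm_homExtend_le (p : DualBall V → DualBall V) (φ : StrongDual ℝ V) :
    ‖homExtend p φ‖ ≤ ‖φ‖ := by
  rw [homExtend, norm_smul, norm_norm]
  refine mul_le_of_le_one_right (norm_nonneg _) ?_
  exact ContinuousLinearMap.opNorm_le_bound _ zero_le_one fun v => by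
    simpa using (p (normalize φ)).2 v

theorem homExtend_apply_of_adjoint {p : DualBall V → DualBall V} {T : V →L[ℝ] V}
    (hp : ∀ (ψ : DualBall V) (v : V), (p ψ).1 v = ψ.1 (T v)) (φ : StrongDual ℝ V) (v : V) :
    homExtend p φ v = φ (T v) := by
  change ‖φ‖ * (p (normalize φ)).1 v = _
  rw [hp]
  change ‖φ‖ * (‖φ‖⁻¹ * φ (T v)) = _
  rcases eq_or_ne φ 0 with rfl | h
  · simp
  · rw [mul_inv_cancel_left₀ (norm_ne_zero_iff.2 h)]

variable {p : DualBall V → DualBall V}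

theorem homExtend_add (hp : p ∈ EnvSemigroup V) (φ ψ : StrongDual ℝ V) :
    homExtend p (φ + ψ) = homExtend p φ + homExtend p ψ := by
  ext v
  refine closure_minimal (t := {p | homExtend p (φ + ψ) v = homExtend p φ v + homExtend p ψ v})
    ?_ (isClosed_eq (continuous_homExtend_apply _ _)
      ((continuous_homExtend_apply _ _).add (continuous_homExtend_apply _ _))) hp
  rintro q ⟨T, -, hq⟩
  simp [homExtend_apply_of_adjoint hq]

theorem homExtend_smul (hp : p ∈ EnvSemigroup V) (c : ℝ) (φ : StrongDual ℝ V) :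
    homExtend p (c • φ) = c • homExtend p φ := by
  ext v
  refine closure_minimal (t := {p | homExtend p (c • φ) v = c * homExtend p φ v})
    ?_ (isClosed_eq (continuous_homExtend_apply _ _)
      (continuous_const.mul (continuous_homExtend_apply _ _))) hp
  rintro q ⟨T, -, hq⟩
  simp [homExtend_apply_of_adjoint hq]

theorem homExtend_eq (hp : p ∈ EnvSemigroup V) (ψ : DualBall V) :
    homExtend p (WeakDual.toStrongDual ψ.1) = WeakDual.toStrongDual (p ψ).1 := by
  ext v
  refine closure_minimal
    (t := {p | homExtend p (WeakDual.toStrongDual ψ.1) v = (p ψ).1 v})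
    ?_ (isClosed_eq (continuous_homExtend_apply _ _)
      ((continuous_eval v).comp (continuous_apply ψ))) hp
  rintro q ⟨T, -, hq⟩
  simp [homExtend_apply_of_adjoint hq, hq]

/-- Every element of the enveloping semigroup extends to a linear contraction of the dual. -/
theorem exists_extension_of_mem_envSemigroup (hp : p ∈ EnvSemigroup V) :
    ∃ S : StrongDual ℝ V →L[ℝ] StrongDual ℝ V, ‖S‖ ≤ 1 ∧
      ∀ ψ : DualBall V, S (WeakDual.toStrongDual ψ.1) = WeakDual.toStrongDual (p ψ).1 :=
  ⟨LinearMap.mkContinuous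
      { toFun := homExtend p
        map_add' := homExtend_add hp
        map_smul' := homExtend_smul hp } 1 fun φ => by simpa using norm_homExtend_le p φ,
    LinearMap.mkContinuous_norm_le _ zero_le_one _, homExtend_eq hp⟩

theorem envSemigroup_eq_adjMaps
    (h : Function.Surjective (NormedSpace.inclusionInDoubleDual ℝ V)) :
    EnvSemigroup V = adjMaps V := by
  refine subset_antisymm (fun p hp => ?_) subset_closure
  obtain ⟨S, hS, hSp⟩ := exists_extension_of_mem_envSemigroup hp
  let e : V ≃ₗᵢ[ℝ] StrongDual ℝ (StrongDual ℝ V) :=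
    LinearIsometryEquiv.ofSurjective (NormedSpace.inclusionInDoubleDualLi (E := V) ℝ) h
  let T : V →L[ℝ] V := e.symm.toContinuousLinearEquiv.toContinuousLinearMap ∘L
    S.precomp ℝ ∘L NormedSpace.inclusionInDoubleDual ℝ V
  have hT : ∀ v, e (T v) = (NormedSpace.inclusionInDoubleDual ℝ V v).comp S := fun v =>
    e.apply_symm_apply _
  refine ⟨T, ContinuousLinearMap.opNorm_le_bound _ zero_le_one fun v => ?_, fun ψ v => ?_⟩
  · rw [← e.norm_map, hT, mul_comm]
    exact (ContinuousLinearMap.opNorm_comp_le _ _).trans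
      (mul_le_mul (NormedSpace.double_dual_bound ℝ V v) hS (norm_nonneg _) (norm_nonneg _))
  · have h1 := DFunLike.congr_fun (hT v) (WeakDual.toStrongDual ψ.1)
    have h2 : ψ.1 (T v) = S (WeakDual.toStrongDual ψ.1) v := h1
    rw [h2, hSp]
    rfl

theorem continuous_of_mem_adjMaps (hp : p ∈ adjMaps V) : Continuous p := by
  obtain ⟨T, -, hT⟩ := hp
  refine continuous_of_eval fun v => ?_
  simp only [hT]
  exact continuous_eval (T v)

/-- The rank one contraction `w ↦ f w • v` induces `φ ↦ φ v • f` on the dual ball. -/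
theorem truncSMul_mem_adjMaps {v : V} (hv : ‖v‖ ≤ 1) (f : DualBall V) :
    (fun φ : DualBall V => truncSMul (φ.1 v) f) ∈ adjMaps V := by
  refine ⟨(WeakDual.toStrongDual f.1).smulRight v, ?_, fun φ w => ?_⟩
  · refine ContinuousLinearMap.opNorm_le_bound _ zero_le_one fun w => ?_
    rw [ContinuousLinearMap.smulRight_apply, norm_smul, one_mul]
    exact (mul_le_of_le_one_right (norm_nonneg _) hv).trans (f.2 w)
  · rw [truncSMul_apply ((φ.2 v).trans hv)]
    simp [mul_comm]

theorem truncSMul_bidual_mem_envSemigroup (F : StrongDual ℝ (StrongDual ℝ V)) (hF : ‖F‖ ≤ 1)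
    (f : DualBall V) :
    (fun φ : DualBall V => truncSMul (F (WeakDual.toStrongDual φ.1)) f) ∈ EnvSemigroup V := by
  let Φ : WeakDual ℝ (StrongDual ℝ V) → DualBall V → DualBall V := fun G φ =>
    truncSMul (G (WeakDual.toStrongDual φ.1)) f
  have hΦ : Continuous Φ := continuous_pi fun φ =>
    continuous_truncSMul.comp ((WeakDual.eval_continuous _).prodMk continuous_const)
  refine closure_mono ?_
    (mem_closure_image hΦ.continuousAt (mem_closure_inclusionInDoubleDual_closedBall F hF))
  rintro _ ⟨_, ⟨v, hv, rfl⟩, rfl⟩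
  exact truncSMul_mem_adjMaps (by simpa using hv) f

/-- Continuity of the left translation by `p` forces `p` to be weak* continuous. -/
theorem continuous_of_continuous_comp {v : V} (hv : ‖v‖ ≤ 1) {f : DualBall V} (hf : f.1 v = 1)
    (hp : Continuous fun q : EnvSemigroup V => p ∘ (q : DualBall V → DualBall V)) :
    Continuous p := by
  let Q : DualBall V → EnvSemigroup V := fun g =>
    ⟨fun φ => truncSMul (φ.1 v) g, subset_closure (truncSMul_mem_adjMaps hv g)⟩
  have hQ : Continuous Q := Continuous.subtype_mk (continuous_pi fun φ =>
    continuous_truncSMul.comp (continuous_const.prodMk continuous_id)) _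
  have hQf : ∀ g, (Q g).1 f = g := fun g => ext_eval fun w => by
    change (truncSMul (f.1 v) g).1 w = _
    rw [truncSMul_apply (by simp [hf]), hf, one_mul]
  have := (continuous_apply f).comp (hp.comp hQ)
  simpa [Function.comp_def, hQf] using this

theorem surjective_inclusionInDoubleDual_of_continuous_comp [CompleteSpace V]
    (h : ∀ p ∈ EnvSemigroup V,
      Continuous fun q : EnvSemigroup V => p ∘ (q : DualBall V → DualBall V)) :
    Function.Surjective (NormedSpace.inclusionInDoubleDual ℝ V) := by
  intro F
  rcases subsingleton_or_nontrivial V with hV | hV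
  · have : Subsingleton (StrongDual ℝ V) := ⟨fun φ ψ => by ext v; simp [Subsingleton.elim v 0]⟩
    exact ⟨0, by ext φ; simp [Subsingleton.elim φ 0]⟩
  obtain ⟨v, hv⟩ := exists_norm_eq V zero_le_one
  obtain ⟨g, hg, hgv⟩ := exists_dual_vector'' ℝ v
  let f : DualBall V := ofNormLE g hg
  have hf : f.1 v = 1 := by
    change g v = 1
    simp [hgv, hv]
  have hball : ∀ G : StrongDual ℝ (StrongDual ℝ V), ‖G‖ ≤ 1 →
      G ∈ range (NormedSpace.inclusionInDoubleDual ℝ V) := by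
    intro G hG
    have hmem := truncSMul_bidual_mem_envSemigroup G hG f
    have hcont := (continuous_eval v).comp
      (continuous_of_continuous_comp hv.le hf (h _ hmem))
    refine mem_range_inclusionInDoubleDual_of_continuous G ?_
    refine hcont.congr fun φ => ?_
    have hφ : ‖WeakDual.toStrongDual φ.1‖ ≤ 1 :=
      ContinuousLinearMap.opNorm_le_bound _ zero_le_one fun w => by simpa using φ.2 w
    have hGφ : |G (WeakDual.toStrongDual φ.1)| ≤ 1 := by
      simpa using G.le_of_opNorm_le_of_le hG hφ
    simp only [Function.comp_apply]
    rw [truncSMul_apply hGφ, hf, mul_one]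
  obtain ⟨w, hw⟩ := hball (‖F‖⁻¹ • F) (by
    rw [norm_smul, norm_inv, norm_norm]
    exact inv_mul_le_one)
  refine ⟨‖F‖ • w, ?_⟩
  rw [map_smul, hw]
  rcases eq_or_ne F 0 with rfl | hF
  · simp
  · rw [smul_inv_smul₀ (norm_ne_zero_iff.2 hF)]

end EnvSemigroup

/-- `V` is reflexive iff `E(V) = {T*|_{B*} : T ∈ Θ(V)}` iff all left
translations of `E(V)` are continuous (i.e. `E(V)` is a semitopological semigroup). -/
theorem stmt2 (V : Type*) [NormedAddCommGroup V] [NormedSpace ℝ V] [CompleteSpace V] :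
    List.TFAE
      [Function.Surjective ⇑(NormedSpace.inclusionInDoubleDual ℝ V),
       EnvSemigroup V = adjMaps V,
       ∀ p ∈ EnvSemigroup V,
         Continuous fun q : EnvSemigroup V => p ∘ (q : DualBall V → DualBall V)] := by
  tfae_have 1 → 2 := envSemigroup_eq_adjMaps
  tfae_have 2 → 3 := fun h p hp => continuous_pi fun φ =>
    (continuous_of_mem_adjMaps (h ▸ hp)).comp
      ((continuous_apply φ).comp continuous_subtype_val)
  tfae_have 3 → 1 := surjective_inclusionInDoubleDual_of_continuous_comp
  tfae_finish
end

section
/- (Dynamical BFT dichotomy) Let S be a monoid acting on a compact metrizable space X such that every translation λ_s : X → X, x ↦ s·x, is continuous, and let E(X) be the enveloping semigroup of this action. Exactly one of the following holds: either every element of E(X) is a fragmented self-map of X, in which case the cardinality of E(X) is at most 2^{ℵ₀}; or some element of E(X) is not fragmented, in which case E(X) contains a homeomorphic copy of βℕ, the Stone–Čech compactification of the discrete natural numbers, and the cardinality of E(X) equals 2^{2^{ℵ₀}}. -/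
/-- The enveloping semigroup of an action of `S` on `X`: the pointwise closure of the set
of translations `x ↦ s • x` in the product space `X^X`. -/
def envSet (S X : Type*) [SMul S X] [TopologicalSpace X] : Set (X → X) :=
  closure {f : X → X | ∃ s : S, f = fun x => s • x}

/-- A map `p` from a topological space `X` to a (compact Hausdorff) space `Y` is fragmented
if for every nonempty `A ⊆ X` and every entourage `ε` (a neighborhood of the diagonal of
`Y`, i.e. a member of the unique compatible uniformity of the compact Hausdorff space `Y`)
there is an open `O` meeting `A` with `p (O ∩ A)` `ε`-small. -/
def IsFragmentedMap {X Y : Type*} [TopologicalSpace X] [TopologicalSpace Y]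
    (p : X → Y) : Prop :=
  ∀ A : Set X, A.Nonempty → ∀ ε ∈ nhdsSet (Set.diagonal Y),
    ∃ O : Set X, IsOpen O ∧ (O ∩ A).Nonempty ∧
      ∀ a ∈ O ∩ A, ∀ b ∈ O ∩ A, (p a, p b) ∈ ε

open Set Filter Topology Cardinal

/-- A non-fragmented map takes values in each of two sets with disjoint closures on a dense part
of a suitable set `A`. -/
theorem exists_dense_pair_of_not_isFragmentedMap {X Y : Type*} [TopologicalSpace X]
    [MetricSpace Y] [CompactSpace Y] {p : X → Y} (hp : ¬ IsFragmentedMap p) :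
    ∃ (A : Set X) (U V : Set Y), A.Nonempty ∧ IsOpen U ∧ IsOpen V ∧
      Disjoint (closure U) (closure V) ∧ ∀ W : Set X, IsOpen W → (W ∩ A).Nonempty →
        (∃ a ∈ W ∩ A, p a ∈ U) ∧ ∃ b ∈ W ∩ A, p b ∈ V := by
  unfold IsFragmentedMap at hp
  push Not at hp
  obtain ⟨A, hA, ε, hε, h⟩ := hp
  rw [nhdsSet_diagonal_eq_uniformity, Metric.mem_uniformity_dist] at hε
  obtain ⟨r, hr, hε⟩ := hε
  obtain ⟨t, -, htfin, ht⟩ :=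
    finite_cover_balls_of_compact (isCompact_univ (X := Y)) (e := r / 8) (by positivity)
  have hcov (y : Y) : ∃ c ∈ t, y ∈ Metric.ball c (r / 8) := by simpa using ht (mem_univ y)
  let I (O : Set X) : Set Y := {c ∈ t | ∃ a ∈ O ∩ A, p a ∈ Metric.ball c (r / 8)}
  have hIfin (O : Set X) : (I O).Finite := htfin.subset fun c hc => hc.1
  obtain ⟨O, ⟨hO, hOA⟩, hmin⟩ := (measure fun O => (I O).ncard).wf.has_min
    {O : Set X | IsOpen O ∧ (O ∩ A).Nonempty} ⟨univ, isOpen_univ, by simpa using hA⟩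
  obtain ⟨a, ha, b, hb, hab⟩ := h O hO hOA
  obtain ⟨c, hct, hc⟩ := hcov (p a)
  obtain ⟨d, hdt, hd⟩ := hcov (p b)
  have hdist : r ≤ dist (p a) (p b) := by
    by_contra! hlt
    exact hab (hε hlt)
  have hcd : r / 8 + r / 8 < dist c d := by
    rw [Metric.mem_ball] at hc hd
    have h₁ := dist_triangle4 (p a) c d (p b)
    rw [dist_comm d] at h₁
    linarith
  have key (W : Set X) (hW : IsOpen W) (hWA : (W ∩ (O ∩ A)).Nonempty) : I O ⊆ I (W ∩ O) := by
    have hsub : I (W ∩ O) ⊆ I O := fun e ⟨het, x, hx, hxe⟩ => ⟨het, x, ⟨hx.1.2, hx.2⟩, hxe⟩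
    have hle := hmin (W ∩ O) ⟨hW.inter hO, by rwa [inter_assoc]⟩
    exact (eq_of_subset_of_ncard_le hsub (not_lt.1 hle) (hIfin O)).ge
  refine ⟨O ∩ A, Metric.ball c (r / 8), Metric.ball d (r / 8), hOA, Metric.isOpen_ball,
    Metric.isOpen_ball, (Metric.closedBall_disjoint_closedBall hcd).mono
      Metric.closure_ball_subset_closedBall Metric.closure_ball_subset_closedBall,
    fun W hW hWA => ?_⟩
  rw [← inter_assoc]
  exact ⟨(key W hW hWA ⟨hct, a, ha, hc⟩).2, (key W hW hWA ⟨hdt, b, hb, hd⟩).2⟩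

/-- Every sub-collection `G` of `F` is realized by a point of `A` sent into `U` by the members
of `G` and into `V` by the other members of `F`. -/
def IsIndependentOn {X Y : Type*} (A : Set X) (U V : Set Y) (F : Set (X → Y)) : Prop :=
  ∀ G ⊆ F, ∃ a ∈ A, (∀ f ∈ G, f a ∈ U) ∧ ∀ f ∈ F \ G, f a ∈ V

theorem IsIndependentOn.mono {X Y : Type*} {A : Set X} {U V : Set Y} {F F' : Set (X → Y)}
    (hF : IsIndependentOn A U V F) (h : F' ⊆ F) : IsIndependentOn A U V F' := fun G hG => by
  obtain ⟨a, ha, hU, hV⟩ := hF G (hG.trans h)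
  exact ⟨a, ha, hU, fun f hf => hV f ⟨h hf.1, hf.2⟩⟩

/-- A finite independent family in `K` can be enlarged when `K` accumulates at a map taking
values densely in both `U` and `V`. -/
theorem IsIndependentOn.exists_insert {X Y : Type*} [TopologicalSpace X] [TopologicalSpace Y]
    {A : Set X} {U V : Set Y} {K F : Set (X → Y)} {p : X → Y} (hK : ∀ f ∈ K, Continuous f)
    (hp : p ∈ closure K) (hU : IsOpen U) (hV : IsOpen V) (hUV : Disjoint U V)
    (hdense : ∀ W : Set X, IsOpen W → (W ∩ A).Nonempty →
      (∃ a ∈ W ∩ A, p a ∈ U) ∧ ∃ b ∈ W ∩ A, p b ∈ V)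
    (hFK : F ⊆ K) (hFfin : F.Finite) (hF : IsIndependentOn A U V F) :
    ∃ f ∈ K, f ∉ F ∧ IsIndependentOn A U V (insert f F) := by
  have hstep (G : Set (X → Y)) (hG : G ⊆ F) :
      (∃ a ∈ A, ((∀ f ∈ G, f a ∈ U) ∧ ∀ f ∈ F \ G, f a ∈ V) ∧ p a ∈ U) ∧
        ∃ b ∈ A, ((∀ f ∈ G, f b ∈ U) ∧ ∀ f ∈ F \ G, f b ∈ V) ∧ p b ∈ V := by
    have hW : IsOpen ((⋂ f ∈ G, f ⁻¹' U) ∩ ⋂ f ∈ F \ G, f ⁻¹' V) :=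
      ((hFfin.subset hG).isOpen_biInter fun f hf => hU.preimage (hK f (hFK (hG hf)))).inter
        ((hFfin.subset sdiff_subset).isOpen_biInter fun f hf => hV.preimage (hK f (hFK hf.1)))
    obtain ⟨x, hxA, hx⟩ := hF G hG
    obtain ⟨⟨a, ha, hpa⟩, b, hb, hpb⟩ := hdense _ hW ⟨x, by simpa using hx, hxA⟩
    exact ⟨⟨a, ha.2, by simpa using ha.1, hpa⟩, b, hb.2, by simpa using hb.1, hpb⟩
  have : Nonempty X := let ⟨x, _⟩ := hF F subset_rfl; ⟨x⟩
  choose! a haA ha hpa using fun G hG => (hstep G hG).1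
  choose! b hbA hb hpb using fun G hG => (hstep G hG).2
  have hev : ∀ᶠ f in 𝓝 p, ∀ G ∈ {G | G ⊆ F}, f (a G) ∈ U ∧ f (b G) ∈ V := by
    rw [eventually_all_finite hFfin.finite_subsets]
    exact fun G hG =>
      ((continuous_apply (a G)).continuousAt.eventually_mem (hU.mem_nhds (hpa G hG))).and
        ((continuous_apply (b G)).continuousAt.eventually_mem (hV.mem_nhds (hpb G hG)))
  obtain ⟨f, hfK, hf⟩ := ((mem_closure_iff_frequently.1 hp).and_eventually hev).exists
  refine ⟨f, hfK, fun hfF => ?_, fun G hG => ?_⟩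
  · exact hUV.le_bot ⟨(hb F subset_rfl).1 f hfF, (hf F (Subset.refl F)).2⟩
  · have hGF : G \ {f} ⊆ F := by rwa [sdiff_singleton_subset_iff]
    by_cases hfG : f ∈ G
    · refine ⟨a (G \ {f}), haA _ hGF, fun g hg => ?_, fun g hg => (ha _ hGF).2 g ?_⟩
      · by_cases hgf : g = f
        · exact hgf ▸ (hf _ hGF).1
        · exact (ha _ hGF).1 g ⟨hg, hgf⟩
      · exact ⟨hg.1.resolve_left fun hgf => hg.2 (hgf ▸ hfG), fun h => hg.2 h.1⟩
    · refine ⟨b (G \ {f}), hbA _ hGF, fun g hg => ?_, fun g hg => ?_⟩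
      · exact (hb _ hGF).1 g ⟨hg, fun hgf => hfG (hgf ▸ hg)⟩
      · by_cases hgf : g = f
        · exact hgf ▸ (hf _ hGF).2
        · exact (hb _ hGF).2 g ⟨hg.1.resolve_left hgf, fun h => hg.2 h.1⟩

/-- A set of continuous maps with a non-fragmented map in its pointwise closure contains a
sequence that realizes every subset of `ℕ` by a pair of closed disjoint sets. -/
theorem exists_independent_seq {X Y : Type*} [TopologicalSpace X] [CompactSpace X]
    [MetricSpace Y] [CompactSpace Y] {K : Set (X → Y)} {p : X → Y}
    (hK : ∀ f ∈ K, Continuous f) (hp : p ∈ closure K) (hfrag : ¬ IsFragmentedMap p) :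
    ∃ (e : ℕ → X → Y) (C D : Set Y), (∀ n, e n ∈ K) ∧ IsClosed C ∧ IsClosed D ∧ Disjoint C D ∧
      ∀ M : Set ℕ, ∃ x, (∀ n ∈ M, e n x ∈ C) ∧ ∀ n ∉ M, e n x ∈ D := by
  obtain ⟨A, U, V, hA, hU, hV, hUV, hdense⟩ := exists_dense_pair_of_not_isFragmentedMap hfrag
  let 𝓕 : Set (Set (X → Y)) := {T | ∀ F ⊆ T, F.Finite → F ⊆ K ∧ IsIndependentOn A U V F}
  have hchar : Order.IsOfFiniteCharacter 𝓕 := fun T =>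
    ⟨fun hT F hF _ F' hF' => hT F' (hF'.trans hF),
      fun hT F hF hfin => hT F hF hfin F subset_rfl hfin⟩
  have hempty : ∅ ∈ 𝓕 := fun F hF _ => by
    obtain rfl := subset_empty_iff.1 hF
    obtain ⟨a, ha⟩ := hA
    exact ⟨empty_subset _, fun G hG => ⟨a, ha, fun f hf => (hG hf).elim, fun f hf => hf.1.elim⟩⟩
  obtain ⟨T, -, hT, hmax⟩ := hchar.exists_maximal hempty
  have hinf : T.Infinite := fun hfin => by
    obtain ⟨hTK, hTind⟩ := hT T subset_rfl hfin
    obtain ⟨f, hfK, hfT, hf⟩ := hTind.exists_insert hK hp hU hV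
      (hUV.mono subset_closure subset_closure) hdense hTK hfin
    exact hfT (hmax (y := insert f T)
      (fun F hF _ => ⟨hF.trans (insert_subset hfK hTK), hf.mono hF⟩)
      (subset_insert f T) (mem_insert f T))
  let e (n : ℕ) : X → Y := hinf.natEmbedding T n
  have he : Function.Injective e := Subtype.val_injective.comp (hinf.natEmbedding T).injective
  have heT (n : ℕ) : e n ∈ T := (hinf.natEmbedding T n).2
  have heK (n : ℕ) : e n ∈ K :=
    (hT {e n} (singleton_subset_iff.2 (heT n)) (finite_singleton _)).1 rfl
  refine ⟨e, closure U, closure V, heK, isClosed_closure, isClosed_closure, hUV, fun M => ?_⟩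
  let Z (n : ℕ) : Set X := {x | (n ∈ M → e n x ∈ closure U) ∧ (n ∉ M → e n x ∈ closure V)}
  have hZ (n : ℕ) : IsClosed (Z n) := by
    by_cases hn : n ∈ M
    · simpa [Z, hn, preimage] using (isClosed_closure (s := U)).preimage (hK _ (heK n))
    · simpa [Z, hn, preimage] using (isClosed_closure (s := V)).preimage (hK _ (heK n))
  obtain ⟨x, hx⟩ := CompactSpace.iInter_nonempty hZ fun u => by
    obtain ⟨a, -, haU, haV⟩ := (hT (e '' u) (image_subset_iff.2 fun n _ => heT n)
      (u.finite_toSet.image e)).2 (e '' (M ∩ u)) (image_mono inter_subset_right)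
    refine ⟨a, mem_iInter₂.2 fun n hn => ⟨fun hM => ?_, fun hM => ?_⟩⟩
    · exact subset_closure (haU _ ⟨n, ⟨hM, hn⟩, rfl⟩)
    · refine subset_closure (haV _ ⟨⟨n, hn, rfl⟩, ?_⟩)
      rw [he.mem_set_image]
      exact fun h => hM h.1
  rw [mem_iInter] at hx
  exact ⟨x, fun n => (hx n).1, fun n => (hx n).2⟩

theorem exists_isEmbedding_stoneCech_closure {X Y : Type*} [TopologicalSpace X] [CompactSpace X]
    [MetricSpace Y] [CompactSpace Y] {K : Set (X → Y)} {p : X → Y}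
    (hK : ∀ f ∈ K, Continuous f) (hp : p ∈ closure K) (hfrag : ¬ IsFragmentedMap p) :
    ∃ φ : StoneCech ℕ → closure K, IsEmbedding φ := by
  obtain ⟨e, C, D, heK, hC, hD, hCD, hind⟩ := exists_independent_seq hK hp hfrag
  let g (n : ℕ) : closure K := ⟨e n, subset_closure (heK n)⟩
  have hg : Continuous g := continuous_of_discreteTopology
  have : CompactSpace (closure K) := isCompact_iff_compactSpace.1 isClosed_closure.isCompact
  have hφ := continuous_stoneCechExtend hg
  refine ⟨stoneCechExtend hg, (hφ.isClosedEmbedding fun z w hzw => ?_).isEmbedding⟩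
  by_contra hne
  obtain ⟨O, O', hO, hO', hz, hw, hdisj⟩ := t2_separation hne
  obtain ⟨x, hxC, hxD⟩ := hind (stoneCechUnit ⁻¹' O)
  have hcont : Continuous fun v : StoneCech ℕ => (stoneCechExtend hg v).1 x :=
    (continuous_apply x).comp (continuous_subtype_val.comp hφ)
  have hmem {Q : Set (StoneCech ℕ)} {v : StoneCech ℕ} {B : Set Y} (hQ : IsOpen Q) (hv : v ∈ Q)
      (hB : IsClosed B) (h : ∀ n, stoneCechUnit n ∈ Q → e n x ∈ B) :
      (stoneCechExtend hg v).1 x ∈ B := by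
    have hcl : v ∈ closure (Q ∩ range (stoneCechUnit : ℕ → StoneCech ℕ)) :=
      denseRange_stoneCechUnit.open_subset_closure_inter hQ hv
    refine (closure_minimal ?_ (hB.preimage hcont)) hcl
    rintro _ ⟨hq, n, rfl⟩
    simpa [g] using h n hq
  have h₁ := hmem hO hz hC hxC
  have h₂ := hmem hO' hw hD fun n hn => hxD n fun h => hdisj.le_bot ⟨h, hn⟩
  rw [hzw] at h₁
  exact hCD.le_bot ⟨h₁, h₂⟩

/-- The cube `X → Bool` over a second countable T₁ space is separable: the indicators of finite
unions of basic open sets are dense. -/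
theorem exists_denseRange_nat_pi_bool (X : Type*) [TopologicalSpace X]
    [SecondCountableTopology X] [T1Space X] : ∃ d : ℕ → X → Bool, DenseRange d := by
  classical
  let B := TopologicalSpace.countableBasis X
  have hB := TopologicalSpace.isBasis_countableBasis X
  have : Countable B := (TopologicalSpace.countable_countableBasis X).to_subtype
  let d (s : Finset B) (x : X) : Bool := decide (∃ b ∈ s, x ∈ (b : Set X))
  suffices hd : DenseRange d by
    obtain ⟨q, hq⟩ := exists_surjective_nat (Finset B)
    exact ⟨d ∘ q, by rwa [DenseRange, hq.range_comp]⟩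
  refine dense_iff_inter_open.2 fun W hW ⟨f, hf⟩ => ?_
  obtain ⟨I, u, hu, hIW⟩ := isOpen_pi_iff.1 hW f hf
  have hsep (x : X) : ∃ b : B, x ∈ (b : Set X) ∧ ∀ y ∈ I, y ∈ (b : Set X) → y = x := by
    obtain ⟨b, hb, hxb, hbI⟩ := hB.exists_subset_of_mem_open
      (show x ∈ ((I.erase x : Finset X) : Set X)ᶜ by simp)
      (I.erase x).finite_toSet.isClosed.isOpen_compl
    refine ⟨⟨b, hb⟩, hxb, fun y hy hyb => ?_⟩
    by_contra hne
    exact hbI hyb (by simp [hne, hy])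
  choose b hxb hbI using hsep
  refine ⟨_, hIW fun x hx => ?_, ({x ∈ I | f x = true}.image b), rfl⟩
  suffices d ({x ∈ I | f x = true}.image b) x = f x from this ▸ (hu x hx).2
  rw [Bool.eq_iff_iff]
  simp only [d, decide_eq_true_eq, Finset.mem_image, Finset.mem_filter]
  constructor
  · rintro ⟨_, ⟨y, ⟨-, hfy⟩, rfl⟩, hxy⟩
    exact hbI y x hx hxy ▸ hfy
  · exact fun hfx => ⟨b x, ⟨x, ⟨hx, hfx⟩, rfl⟩, hxb x⟩

theorem two_power_two_power_aleph0_le_mk_stoneCech :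
    (2 : Cardinal) ^ ((2 : Cardinal) ^ ℵ₀) ≤ #(StoneCech ℕ) := by
  obtain ⟨d, hd⟩ := exists_denseRange_nat_pi_bool (ℕ → Bool)
  have hcont : Continuous d := continuous_of_discreteTopology
  have hsurj : Function.Surjective (stoneCechExtend hcont) := by
    rw [← range_eq_univ, ← (isCompact_range (continuous_stoneCechExtend hcont)).isClosed.closure_eq]
    refine (hd.mono ?_).closure_eq
    rintro _ ⟨n, rfl⟩
    exact ⟨stoneCechUnit n, by simp⟩
  simpa using mk_le_of_surjective hsurj

theorem mk_opens_le_two_power_aleph0 (X : Type*) [TopologicalSpace X]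
    [SecondCountableTopology X] : #(TopologicalSpace.Opens X) ≤ 2 ^ ℵ₀ := by
  have hB := TopologicalSpace.isBasis_countableBasis X
  have hinj : Function.Injective fun (O : TopologicalSpace.Opens X) =>
      {b : TopologicalSpace.countableBasis X | (b : Set X) ⊆ O} := fun O O' h => by
    have hle {P Q : TopologicalSpace.Opens X}
        (h : {b : TopologicalSpace.countableBasis X | (b : Set X) ⊆ P} ⊆ {b | (b : Set X) ⊆ Q}) :
        P ≤ Q := fun x hx => by
      obtain ⟨b, hb, hxb, hbP⟩ := hB.exists_subset_of_mem_open hx P.isOpen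
      exact h (a := ⟨b, hb⟩) hbP hxb
    exact le_antisymm (hle (subset_of_eq h)) (hle (subset_of_eq h.symm))
  refine (mk_le_of_injective hinj).trans ?_
  rw [mk_set]
  exact power_le_power_left two_ne_zero
    (mk_le_aleph0_iff.2 (TopologicalSpace.countable_countableBasis X).to_subtype)

theorem mk_le_two_power_aleph0 (X : Type*) [TopologicalSpace X] [SecondCountableTopology X]
    [T1Space X] : #X ≤ 2 ^ ℵ₀ := by
  refine (mk_le_of_injective (f := fun x : X => (⟨{x}ᶜ, isOpen_compl_singleton⟩ :
    TopologicalSpace.Opens X)) fun x y h => ?_).trans (mk_opens_le_two_power_aleph0 X)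
  simpa using h

/-- A fragmented map is, up to `r`, constant on the pieces of a countable cover by locally closed
sets, each written as a difference of two open sets. -/
theorem IsFragmentedMap.exists_countable_cover {X Y : Type*} [TopologicalSpace X]
    [SecondCountableTopology X] [MetricSpace Y] [CompactSpace Y] {p : X → Y}
    (hp : IsFragmentedMap p) {r : ℝ} (hr : 0 < r) :
    ∃ 𝓢 : Set (TopologicalSpace.Opens X × TopologicalSpace.Opens X), 𝓢.Countable ∧
      (∀ x, ∃ P ∈ 𝓢, x ∈ (P.1 : Set X) \ P.2) ∧
      ∀ P ∈ 𝓢, ∀ a ∈ (P.1 : Set X) \ P.2, ∀ b ∈ (P.1 : Set X) \ P.2, dist (p a) (p b) < r := by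
  let 𝓖 : Set (Set X) := {O | IsOpen O ∧
    ∃ 𝓢 : Set (TopologicalSpace.Opens X × TopologicalSpace.Opens X), 𝓢.Countable ∧
      (∀ x ∈ O, ∃ P ∈ 𝓢, x ∈ (P.1 : Set X) \ P.2) ∧
      ∀ P ∈ 𝓢, ∀ a ∈ (P.1 : Set X) \ P.2, ∀ b ∈ (P.1 : Set X) \ P.2, dist (p a) (p b) < r}
  have hopen : IsOpen (⋃₀ 𝓖) := isOpen_sUnion fun O hO => hO.1
  obtain ⟨T, hTc, hT𝓖, hTU⟩ := TopologicalSpace.isOpen_sUnion_countable 𝓖 fun O hO => hO.1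
  choose! 𝓢 h𝓢c h𝓢cov h𝓢 using fun O (hO : O ∈ 𝓖) => hO.2
  have hcov : ∀ x ∈ ⋃₀ 𝓖, ∃ P ∈ ⋃ O ∈ T, 𝓢 O, x ∈ (P.1 : Set X) \ P.2 := fun x hx => by
    rw [← hTU] at hx
    obtain ⟨O, hO, hxO⟩ := hx
    obtain ⟨P, hP, hxP⟩ := h𝓢cov O (hT𝓖 hO) x hxO
    exact ⟨P, mem_biUnion hO hP, hxP⟩
  have hcount : (⋃ O ∈ T, 𝓢 O).Countable := hTc.biUnion fun O hO => h𝓢c O (hT𝓖 hO)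
  have hsmall : ∀ P ∈ ⋃ O ∈ T, 𝓢 O, ∀ a ∈ (P.1 : Set X) \ P.2, ∀ b ∈ (P.1 : Set X) \ P.2,
      dist (p a) (p b) < r := fun P hP => by
    obtain ⟨O, hO, hPO⟩ := mem_iUnion₂.1 hP
    exact h𝓢 O (hT𝓖 hO) P hPO
  suffices huniv : ⋃₀ 𝓖 = Set.univ from ⟨_, hcount, fun x => hcov x (huniv ▸ mem_univ x), hsmall⟩
  by_contra hne
  obtain ⟨O, hO, ⟨x, hxO, hx⟩, hOr⟩ := hp (⋃₀ 𝓖)ᶜ (nonempty_compl.2 hne)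
    {q | dist q.1 q.2 < r}
    (by rw [nhdsSet_diagonal_eq_uniformity]; exact Metric.dist_mem_uniformity hr)
  refine hx (mem_sUnion_of_mem (mem_union_left _ hxO) (t := O ∪ ⋃₀ 𝓖) ⟨hO.union hopen,
    insert (⟨O, hO⟩, ⟨⋃₀ 𝓖, hopen⟩) (⋃ O ∈ T, 𝓢 O), hcount.insert _, fun y hy => ?_, ?_⟩)
  · by_cases hyU : y ∈ ⋃₀ 𝓖
    · obtain ⟨P, hP, hyP⟩ := hcov y hyU
      exact ⟨P, mem_insert_of_mem _ hP, hyP⟩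
    · exact ⟨_, mem_insert _ _, hy.resolve_right hyU, hyU⟩
  · rintro P (rfl | hP)
    · exact hOr
    · exact hsmall P hP

theorem IsFragmentedMap.exists_seq_approx {X Y : Type*} [TopologicalSpace X]
    [SecondCountableTopology X] [MetricSpace Y] [CompactSpace Y] [Nonempty Y] {p : X → Y}
    (hp : IsFragmentedMap p) {r : ℝ} (hr : 0 < r) :
    ∃ D : ℕ → (TopologicalSpace.Opens X × TopologicalSpace.Opens X) × Y,
      (∀ x, ∃ n, x ∈ ((D n).1.1 : Set X) \ (D n).1.2) ∧
      ∀ n, ∀ a ∈ ((D n).1.1 : Set X) \ (D n).1.2, dist (p a) (D n).2 < r := by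
  obtain ⟨𝓢, hc, hcov, hsmall⟩ := hp.exists_countable_cover hr
  have hy (P : TopologicalSpace.Opens X × TopologicalSpace.Opens X) : ∃ y : Y, P ∈ 𝓢 →
      ∀ a ∈ (P.1 : Set X) \ P.2, dist (p a) y < r := by
    rcases ((P.1 : Set X) \ P.2).eq_empty_or_nonempty with h | ⟨b, hb⟩
    · simp [h]
    · exact ⟨p b, fun hP a ha => hsmall P hP a ha b hb⟩
  choose y hy using hy
  rcases 𝓢.eq_empty_or_nonempty with rfl | hne
  · exact ⟨fun _ => ((⊥, ⊥), Classical.arbitrary Y), fun x => by simpa using hcov x, by simp⟩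
  · obtain ⟨P, rfl⟩ := hc.exists_eq_range hne
    refine ⟨fun n => (P n, y (P n)), fun x => ?_, fun n => hy (P n) (mem_range_self n)⟩
    simpa using hcov x

theorem mk_le_of_forall_isFragmentedMap {X : Type*} [MetricSpace X] [CompactSpace X]
    {E : Set (X → X)} (hE : ∀ p ∈ E, IsFragmentedMap p) : #E ≤ 2 ^ ℵ₀ := by
  rcases isEmpty_or_nonempty X with hX | hX
  · exact (le_one_iff_subsingleton.2 inferInstance).trans
      (one_le_aleph0.trans (cantor ℵ₀).le)
  choose D hcov happrox using fun (p : E) (m : ℕ) =>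
    (hE p p.2).exists_seq_approx (Nat.one_div_pos_of_nat (α := ℝ) (n := m))
  have hinj : Function.Injective D := fun p q hpq => Subtype.ext <| funext fun x => by
    refine eq_of_forall_dist_le fun r hr => ?_
    obtain ⟨m, hm⟩ := exists_nat_one_div_lt (half_pos hr)
    obtain ⟨n, hn⟩ := hcov p m x
    have h₁ := happrox p m n x hn
    rw [hpq] at hn h₁
    have h₂ := happrox q m n x hn
    linarith [dist_triangle_right (p.1 x) (q.1 x) (D q m n).2]
  have hdata : #((TopologicalSpace.Opens X × TopologicalSpace.Opens X) × X) ≤ 2 ^ ℵ₀ := by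
    rw [mk_prod, mk_prod, lift_id, lift_id, lift_id]
    calc _ ≤ (2 ^ ℵ₀ * 2 ^ ℵ₀ * 2 ^ ℵ₀ : Cardinal) := by
          gcongr
          exacts [mk_opens_le_two_power_aleph0 X, mk_opens_le_two_power_aleph0 X,
            mk_le_two_power_aleph0 X]
      _ = 2 ^ ℵ₀ := by simp [two_power_aleph0]
  refine (mk_le_of_injective hinj).trans ?_
  simp only [mk_pi, prod_const, mk_nat, lift_aleph0, lift_uzero]
  calc _ ≤ (((2 ^ ℵ₀) ^ ℵ₀) ^ ℵ₀ : Cardinal) := power_le_power_right (power_le_power_right hdata)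
    _ = 2 ^ ℵ₀ := by simp [two_power_aleph0]

/-- Dynamical BFT dichotomy: for a monoid `S` acting on a compact metrizable
space `X` with continuous translations, either every element of `E(X)` is fragmented and
then `card E(X) ≤ 2^ℵ₀`, or some element of `E(X)` is not fragmented and then `E(X)`
contains a homeomorphic copy of `βℕ` and `card E(X) = 2^(2^ℵ₀)`. -/
theorem stmt8 {S X : Type*} [Monoid S] [TopologicalSpace X] [CompactSpace X]
    [TopologicalSpace.MetrizableSpace X] [MulAction S X]
    (hc : ∀ s : S, Continuous fun x : X => s • x) :
    ((∀ p ∈ envSet S X, IsFragmentedMap p) →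
      Cardinal.mk (envSet S X) ≤ (2 : Cardinal) ^ Cardinal.aleph0) ∧
    ((¬ ∀ p ∈ envSet S X, IsFragmentedMap p) →
      (∃ φ : StoneCech ℕ → envSet S X, Topology.IsEmbedding φ) ∧
      Cardinal.mk (envSet S X) = (2 : Cardinal) ^ ((2 : Cardinal) ^ Cardinal.aleph0)) := by
  let := TopologicalSpace.metrizableSpaceMetric X
  refine ⟨mk_le_of_forall_isFragmentedMap, fun h => ?_⟩
  push Not at h
  obtain ⟨p, hp, hfrag⟩ := h
  obtain ⟨φ, hφ⟩ : ∃ φ : StoneCech ℕ → envSet S X, IsEmbedding φ :=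
    exists_isEmbedding_stoneCech_closure (by rintro _ ⟨s, rfl⟩; exact hc s) hp hfrag
  refine ⟨⟨φ, hφ⟩, le_antisymm ?_ ?_⟩
  · have hX : #X ≤ 2 ^ ℵ₀ := mk_le_two_power_aleph0 X
    calc #(envSet S X) ≤ #(X → X) := mk_set_le _
      _ = #X ^ #X := by simp
      _ ≤ (2 ^ #X) ^ #X := power_le_power_right (cantor _).le
      _ = 2 ^ (#X * #X) := (power_mul ..).symm
      _ ≤ 2 ^ ((2 : Cardinal) ^ ℵ₀ * 2 ^ ℵ₀) :=
        power_le_power_left two_ne_zero (mul_le_mul' hX hX)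
      _ = 2 ^ ((2 : Cardinal) ^ ℵ₀) := by simp [two_power_aleph0]
  · have h₁ := lift_mk_le_lift_mk_of_injective hφ.injective
    have h₂ := lift_le.2 two_power_two_power_aleph0_le_mk_stoneCech
    simpa using h₂.trans h₁
end
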